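/- In H(d,1,n), for every a₁ ∈ Λ₁ and a₂ ∈ Λ₂, both elements z·(a₁a₂) and s₂·(a₁a₂) belong to Span(Λ₁Λ₂). -/

import Mathlib

noncomputable section

open scoped Pointwise

/-- The base ring `R₀ = ℤ[a, b₁, …, b_{d-1}]`, with `a` the variable of index `0`
and `b_i` the variable of index `i` for `1 ≤ i ≤ d-1`. -/
abbrev R0 (d : ℕ) : Type := MvPolynomial (Fin d) ℤ

/-- The variable `a ∈ R₀`. -/
def aV (d : ℕ) : R0 d := if h : 0 < d then MvPolynomial.X (⟨0, h⟩ : Fin d) else 0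

/-- The variable `b_i ∈ R₀` for `1 ≤ i ≤ d-1`. -/
def bV (d i : ℕ) : R0 d := if h : i < d then MvPolynomial.X (⟨i, h⟩ : Fin d) else 0

/-- Generators of the classical presentation of the Hecke algebra `H(d,1,n)`:
`z` and `s_j` for `2 ≤ j ≤ n`. -/
inductive HGen (n : ℕ) : Type
  | z : HGen n
  | s : (j : ℕ) → 2 ≤ j → j ≤ n → HGen n

open FreeAlgebra

/-- The free `R₀`-algebra on the generators. -/
abbrev FA (d n : ℕ) : Type := FreeAlgebra (R0 d) (HGen n)

/-- The defining relations of the Hecke algebra `H(d,1,n)`. -/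
inductive HRel (d n : ℕ) : FA d n → FA d n → Prop
  | zszs (h : 2 ≤ n) :
      HRel d n (ι (R0 d) HGen.z * ι (R0 d) (HGen.s 2 le_rfl h) *
                  ι (R0 d) HGen.z * ι (R0 d) (HGen.s 2 le_rfl h))
               (ι (R0 d) (HGen.s 2 le_rfl h) * ι (R0 d) HGen.z *
                  ι (R0 d) (HGen.s 2 le_rfl h) * ι (R0 d) HGen.z)
  | zs (j : ℕ) (h2 : 2 ≤ j) (h3 : 3 ≤ j) (hn : j ≤ n) :
      HRel d n (ι (R0 d) HGen.z * ι (R0 d) (HGen.s j h2 hn))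
               (ι (R0 d) (HGen.s j h2 hn) * ι (R0 d) HGen.z)
  | braid (i : ℕ) (h2 : 2 ≤ i) (h2' : 2 ≤ i + 1) (hn' : i ≤ n) (hn : i + 1 ≤ n) :
      HRel d n (ι (R0 d) (HGen.s i h2 hn') * ι (R0 d) (HGen.s (i + 1) h2' hn) *
                  ι (R0 d) (HGen.s i h2 hn'))
               (ι (R0 d) (HGen.s (i + 1) h2' hn) * ι (R0 d) (HGen.s i h2 hn') *
                  ι (R0 d) (HGen.s (i + 1) h2' hn))
  | comm (i j : ℕ) (h2i : 2 ≤ i) (hni : i ≤ n) (h2j : 2 ≤ j) (hnj : j ≤ n)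
      (hij : i + 1 < j ∨ j + 1 < i) :
      HRel d n (ι (R0 d) (HGen.s i h2i hni) * ι (R0 d) (HGen.s j h2j hnj))
               (ι (R0 d) (HGen.s j h2j hnj) * ι (R0 d) (HGen.s i h2i hni))
  | zd :
      HRel d n (ι (R0 d) HGen.z ^ d)
               ((∑ i ∈ Finset.Icc 1 (d - 1),
                  algebraMap (R0 d) (FA d n) (bV d i) * ι (R0 d) HGen.z ^ (d - i)) + 1)
  | sq (j : ℕ) (h2 : 2 ≤ j) (hn : j ≤ n) :
      HRel d n (ι (R0 d) (HGen.s j h2 hn) * ι (R0 d) (HGen.s j h2 hn))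
               (algebraMap (R0 d) (FA d n) (aV d) * ι (R0 d) (HGen.s j h2 hn) + 1)

/-- The Hecke algebra `H(d,1,n)`. -/
abbrev Hecke (d n : ℕ) : Type := RingQuot (HRel d n)

/-- The generator `z` of `H(d,1,n)`. -/
def zH (d n : ℕ) : Hecke d n :=
  RingQuot.mkAlgHom (R0 d) (HRel d n) (ι (R0 d) HGen.z)

/-- The generator `s_j` of `H(d,1,n)` (junk value `1` when `j` is out of range). -/
def sH (d n : ℕ) (j : ℕ) : Hecke d n :=
  if h : 2 ≤ j ∧ j ≤ n then RingQuot.mkAlgHom (R0 d) (HRel d n) (ι (R0 d) (HGen.s j h.1 h.2))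
  else 1

/-- Decreasing-index product `s_m s_{m-1} ⋯ s_{i'}` (empty when `m < i'`). -/
def sDescH (d n m i' : ℕ) : Hecke d n :=
  (((List.range' i' (m + 1 - i')).reverse).map (sH d n)).prod

/-- Increasing-index product `s_{i'} s_{i'+1} ⋯ s_m` (empty when `m < i'`). -/
def sAscH (d n i' m : ℕ) : Hecke d n :=
  ((List.range' i' (m + 1 - i')).map (sH d n)).prod

/-- `Λ₁ = {z^k : 0 ≤ k ≤ d-1}` in `H(d,1,n)`. -/
def Lam1 (d n : ℕ) : Set (Hecke d n) := {x | ∃ k < d, x = zH d n ^ k}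

/-- `Λ_m = {1} ∪ {s_m ⋯ s_{i'} : 2 ≤ i' ≤ m} ∪ {s_m ⋯ s₂ z^k : 1 ≤ k ≤ d-1}
∪ {s_m ⋯ s₂ z^k s₂ s₃ ⋯ s_{i'} : 1 ≤ k ≤ d-1, 2 ≤ i' ≤ m}` in `H(d,1,n)`. -/
def LamG (d n m : ℕ) : Set (Hecke d n) :=
  {1} ∪ {x | ∃ i', 2 ≤ i' ∧ i' ≤ m ∧ x = sDescH d n m i'} ∪
    {x | ∃ k, 1 ≤ k ∧ k < d ∧ x = sDescH d n m 2 * zH d n ^ k} ∪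
    {x | ∃ k, 1 ≤ k ∧ k < d ∧ ∃ i', 2 ≤ i' ∧ i' ≤ m ∧
      x = sDescH d n m 2 * zH d n ^ k * sAscH d n 2 i'}


section HeckeAux

variable {R A : Type*} [CommRing R] [Ring A] [Algebra R A]

/-- Filtration by the exponent occurring to the right of the first `s`. -/
def DF (R : Type*) {A : Type*} [CommRing R] [Ring A] [Algebra R A] (z s : A) (k : ℕ) :
    Submodule R A :=
  Submodule.span R {x | ∃ i, x = z ^ i ∨ ∃ j ≤ k, x = z ^ i * (s * z ^ j) ∨
    x = z ^ i * (s * z ^ j * s)}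

theorem DF_mono (z s : A) {k l : ℕ} (h : k ≤ l) : DF R z s k ≤ DF R z s l := by
  apply Submodule.span_mono
  rintro x ⟨i, h1 | ⟨j, hj, h2⟩⟩
  · exact ⟨i, Or.inl h1⟩
  · exact ⟨i, Or.inr ⟨j, hj.trans h, h2⟩⟩

theorem DF_a (z s : A) (k i : ℕ) : z ^ i ∈ DF R z s k :=
  Submodule.subset_span ⟨i, Or.inl rfl⟩

theorem DF_b (z s : A) {k j : ℕ} (i : ℕ) (h : j ≤ k) : z ^ i * (s * z ^ j) ∈ DF R z s k :=
  Submodule.subset_span ⟨i, Or.inr ⟨j, h, Or.inl rfl⟩⟩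

theorem DF_c (z s : A) {k j : ℕ} (i : ℕ) (h : j ≤ k) : z ^ i * (s * z ^ j * s) ∈ DF R z s k :=
  Submodule.subset_span ⟨i, Or.inr ⟨j, h, Or.inr rfl⟩⟩

theorem DF_left (z s : A) {k : ℕ} (m : ℕ) {x : A} (hx : x ∈ DF R z s k) :
    z ^ m * x ∈ DF R z s k := by
  refine Submodule.span_induction (p := fun x _ => z ^ m * x ∈ DF R z s k) ?_ ?_ ?_ ?_ hx
  · rintro x ⟨i, rfl | ⟨j, hj, rfl | rfl⟩⟩
    · rw [← pow_add]; exact DF_a z s k _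
    · rw [← mul_assoc, ← pow_add]; exact DF_b z s _ hj
    · rw [← mul_assoc, ← pow_add]; exact DF_c z s _ hj
  · simp
  · intro x y _ _ h1 h2; rw [mul_add]; exact add_mem h1 h2
  · intro r x _ h; rw [mul_smul_comm]; exact Submodule.smul_mem _ _ h

theorem DF_mul_s (z s : A) (a : R) (hs : s * s = a • s + 1) {k : ℕ} {x : A}
    (hx : x ∈ DF R z s k) : x * s ∈ DF R z s k := by
  refine Submodule.span_induction (p := fun x _ => x * s ∈ DF R z s k) ?_ ?_ ?_ ?_ hx
  · rintro x ⟨i, rfl | ⟨j, hj, rfl | rfl⟩⟩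
    · simpa using DF_b (R := R) z s i (Nat.zero_le k)
    · rw [mul_assoc]; exact DF_c z s _ hj
    · have : z ^ i * (s * z ^ j * s) * s = a • (z ^ i * (s * z ^ j * s)) + z ^ i * (s * z ^ j) := by
        rw [mul_assoc, mul_assoc (s * z ^ j), hs]
        simp [mul_add]
      rw [this]
      exact add_mem (Submodule.smul_mem _ _ (DF_c z s _ hj)) (DF_b z s _ hj)
  · simp
  · intro x y _ _ h1 h2; rw [add_mul]; exact add_mem h1 h2
  · intro r x _ h; rw [smul_mul_assoc]; exact Submodule.smul_mem _ _ h

theorem DF_mul_z_aux (z s : A) {k : ℕ}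
    (H : ∀ j ≤ k, s * z ^ j * s * z ∈ DF R z s (k + 1)) {x : A}
    (hx : x ∈ DF R z s k) : x * z ∈ DF R z s (k + 1) := by
  refine Submodule.span_induction (p := fun x _ => x * z ∈ DF R z s (k + 1)) ?_ ?_ ?_ ?_ hx
  · rintro x ⟨i, rfl | ⟨j, hj, rfl | rfl⟩⟩
    · rw [← pow_succ]; exact DF_a z s _ _
    · rw [mul_assoc, mul_assoc, ← pow_succ]; exact DF_b z s _ (by omega)
    · rw [mul_assoc]; exact DF_left z s _ (H j hj)
  · simp
  · intro x y _ _ h1 h2; rw [add_mul]; exact add_mem h1 h2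
  · intro r x _ h; rw [smul_mul_assoc]; exact Submodule.smul_mem _ _ h

theorem DF_key (z s : A) (a : R) (hs : s * s = a • s + 1)
    (hb : z * s * z * s = s * z * s * z) (k : ℕ) :
    ∀ j ≤ k + 1, s * z ^ j * s * z ∈ DF R z s (k + 1) := by
  induction k with
  | zero =>
    intro j hj
    obtain rfl | rfl : j = 0 ∨ j = 1 := by omega
    · have : s * z ^ 0 * s * z = a • (z ^ 0 * (s * z ^ 1)) + z ^ 1 := by
        simp [hs, add_mul]
      rw [this]
      exact add_mem (Submodule.smul_mem _ _ (DF_b z s _ (by omega))) (DF_a z s _ _)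
    · have : s * z ^ 1 * s * z = z ^ 1 * (s * z ^ 1 * s) := by
        rw [pow_one, ← hb]; noncomm_ring
      rw [this]
      exact DF_c z s _ (by omega)
  | succ k ih =>
    intro j hj
    rcases Nat.lt_or_ge j (k + 2) with h | h
    · exact DF_mono z s (by omega) (ih j (by omega))
    · obtain rfl : j = k + 1 + 1 := by omega
      have hinv : s * (s - a • 1) = 1 := by
        rw [mul_sub, hs]; simp
      have e : s * z ^ (k + 1 + 1) * s * z
          = s * z ^ (k + 1) * s * z * s * z * s - a • (s * z ^ (k + 1) * s * z * s * z) := by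
        have h1 : s * z ^ (k + 1) * s * z * s * z * s - a • (s * z ^ (k + 1) * s * z * s * z)
            = s * z ^ (k + 1) * (s * z * s * z) * (s - a • 1) := by
          rw [mul_sub]; simp [mul_assoc]
        rw [h1, ← hb]
        have h2 : s * z ^ (k + 1) * (z * s * z * s) * (s - a • 1)
            = s * (z ^ (k + 1) * z) * s * z * (s * (s - a • 1)) := by
          simp only [mul_assoc]
        rw [h2, hinv, ← pow_succ, mul_one]
      rw [e]
      have hm : s * z ^ (k + 1) * s * z * s * z ∈ DF R z s (k + 1 + 1) := by
        apply DF_mul_z_aux z s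
        · intro j hj; exact DF_mono z s (by omega) (ih j hj)
        · exact DF_mul_s z s a hs (ih _ le_rfl)
      exact sub_mem (DF_mul_s z s a hs hm) (Submodule.smul_mem _ _ hm)

theorem DF_mul_zpow (z s : A) (a : R) (hs : s * s = a • s + 1)
    (hb : z * s * z * s = s * z * s * z) (m : ℕ) {k : ℕ} {x : A}
    (hx : x ∈ DF R z s (k + 1)) : x * z ^ m ∈ DF R z s (k + m + 1) := by
  induction m with
  | zero => simpa using hx
  | succ m ih =>
    rw [pow_succ, ← mul_assoc]
    refine DF_mul_z_aux z s ?_ ih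
    intro j hj
    exact DF_mono z s (by omega) (DF_key z s a hs hb (k + m) j hj)

end HeckeAux

theorem sDesc22 (d n : ℕ) : sDescH d n 2 2 = sH d n 2 := by simp [sDescH]

theorem sAsc22 (d n : ℕ) : sAscH d n 2 2 = sH d n 2 := by simp [sAscH]

theorem sH_sq (d n : ℕ) (hn : 2 ≤ n) : sH d n 2 * sH d n 2 = aV d • sH d n 2 + 1 := by
  have := RingQuot.mkAlgHom_rel (R0 d) (HRel.sq (d := d) 2 le_rfl hn)
  simpa [sH, hn, Algebra.smul_def] using this

theorem zH_braid (d n : ℕ) (hn : 2 ≤ n) :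
    zH d n * sH d n 2 * zH d n * sH d n 2 = sH d n 2 * zH d n * sH d n 2 * zH d n := by
  have := RingQuot.mkAlgHom_rel (R0 d) (HRel.zszs (d := d) hn)
  simpa [sH, zH, hn] using this

theorem zH_pow_d (d n : ℕ) : zH d n ^ d =
    (∑ i ∈ Finset.Icc 1 (d - 1), bV d i • zH d n ^ (d - i)) + 1 := by
  have := RingQuot.mkAlgHom_rel (R0 d) (HRel.zd (d := d) (n := n))
  simpa [zH, Algebra.smul_def] using this

theorem zH_pow_mem (d n : ℕ) (hd : 2 ≤ d) (k : ℕ) :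
    zH d n ^ k ∈ Submodule.span (R0 d) (Lam1 d n) := by
  induction k using Nat.strong_induction_on with
  | _ k ih =>
    rcases Nat.lt_or_ge k d with h | h
    · exact Submodule.subset_span ⟨k, h, rfl⟩
    · obtain ⟨m, rfl⟩ := Nat.exists_eq_add_of_le h
      rw [pow_add, zH_pow_d, add_mul, Finset.sum_mul, one_mul]
      refine add_mem (Submodule.sum_mem _ ?_) (ih m (by omega))
      intro i hi
      rw [Finset.mem_Icc] at hi
      rw [smul_mul_assoc, ← pow_add]
      exact Submodule.smul_mem _ _ (ih _ (by omega))

theorem span_mul_mem (d n : ℕ) {x y : Hecke d n} (hx : x ∈ Submodule.span (R0 d) (Lam1 d n))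
    (hy : y ∈ Submodule.span (R0 d) (LamG d n 2)) :
    x * y ∈ Submodule.span (R0 d) (Lam1 d n * LamG d n 2) := by
  rw [← Submodule.span_mul_span]
  exact Submodule.mul_mem_mul hx hy

theorem s_mem (d n : ℕ) : sH d n 2 ∈ LamG d n 2 :=
  Or.inl (Or.inl (Or.inr ⟨2, le_rfl, le_rfl, (sDesc22 d n).symm⟩))

theorem sz_mem (d n : ℕ) {y : Hecke d n} (hy : y ∈ Submodule.span (R0 d) (Lam1 d n)) :
    sH d n 2 * y ∈ Submodule.span (R0 d) (LamG d n 2) := by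
  refine Submodule.span_induction
    (p := fun y _ => sH d n 2 * y ∈ Submodule.span (R0 d) (LamG d n 2)) ?_ ?_ ?_ ?_ hy
  · rintro y ⟨k, hk, rfl⟩
    apply Submodule.subset_span
    rcases Nat.eq_zero_or_pos k with rfl | h
    · simpa using s_mem d n
    · exact Or.inl (Or.inr ⟨k, h, hk, by rw [sDesc22]⟩)
  · simp
  · intro x y _ _ h1 h2; rw [mul_add]; exact add_mem h1 h2
  · intro r x _ h; rw [mul_smul_comm]; exact Submodule.smul_mem _ _ h

theorem szs_mem (d n : ℕ) (hn : 2 ≤ n) {y : Hecke d n}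
    (hy : y ∈ Submodule.span (R0 d) (Lam1 d n)) :
    sH d n 2 * y * sH d n 2 ∈ Submodule.span (R0 d) (LamG d n 2) := by
  refine Submodule.span_induction
    (p := fun y _ => sH d n 2 * y * sH d n 2 ∈ Submodule.span (R0 d) (LamG d n 2)) ?_ ?_ ?_ ?_ hy
  · rintro y ⟨k, hk, rfl⟩
    rcases Nat.eq_zero_or_pos k with rfl | h
    · rw [pow_zero, mul_one, sH_sq d n hn]
      exact add_mem (Submodule.smul_mem _ _ (Submodule.subset_span (s_mem d n)))
        (Submodule.subset_span (Or.inl (Or.inl (Or.inl rfl))))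
    · exact Submodule.subset_span
        (Or.inr ⟨k, h, hk, 2, le_rfl, le_rfl, by rw [sDesc22, sAsc22]⟩)
  · simp
  · intro x y _ _ h1 h2; rw [mul_add, add_mul]; exact add_mem h1 h2
  · intro r x _ h; rw [mul_smul_comm, smul_mul_assoc]; exact Submodule.smul_mem _ _ h

theorem DF_le (d n : ℕ) (hd : 2 ≤ d) (hn : 2 ≤ n) (k : ℕ) :
    DF (R0 d) (zH d n) (sH d n 2) k ≤ Submodule.span (R0 d) (Lam1 d n * LamG d n 2) := by
  apply Submodule.span_le.2
  rintro x ⟨i, rfl | ⟨j, hj, rfl | rfl⟩⟩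
  · rw [← mul_one (zH d n ^ i)]
    exact span_mul_mem d n (zH_pow_mem d n hd i)
      (Submodule.subset_span (Or.inl (Or.inl (Or.inl rfl))))
  · exact span_mul_mem d n (zH_pow_mem d n hd i) (sz_mem d n (zH_pow_mem d n hd j))
  · exact span_mul_mem d n (zH_pow_mem d n hd i) (szs_mem d n hn (zH_pow_mem d n hd j))

theorem DF_mul_Lam (d n : ℕ) (hd : 2 ≤ d) (hn : 2 ≤ n) {k : ℕ} {x a2 : Hecke d n}
    (hx : x ∈ DF (R0 d) (zH d n) (sH d n 2) (k + 1)) (ha2 : a2 ∈ LamG d n 2) :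
    x * a2 ∈ Submodule.span (R0 d) (Lam1 d n * LamG d n 2) := by
  have hs := sH_sq d n hn
  have hb := zH_braid d n hn
  have hxs := DF_mul_s _ _ _ hs hx
  rcases ha2 with ((rfl | ⟨i, h1, h2, rfl⟩) | ⟨m, h1, h2, rfl⟩) | ⟨m, h1, h2, i, h3, h4, rfl⟩
  · rw [mul_one]; exact DF_le d n hd hn _ hx
  · obtain rfl : i = 2 := by omega
    rw [sDesc22]; exact DF_le d n hd hn _ hxs
  · rw [sDesc22, ← mul_assoc]
    exact DF_le d n hd hn _ (DF_mul_zpow _ _ _ hs hb m hxs)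
  · obtain rfl : i = 2 := by omega
    rw [sDesc22, sAsc22, ← mul_assoc, ← mul_assoc]
    exact DF_le d n hd hn _ (DF_mul_s _ _ _ hs (DF_mul_zpow _ _ _ hs hb m hxs))

/-- For every `a₁ ∈ Λ₁` and `a₂ ∈ Λ₂`, both `z·(a₁a₂)` and `s₂·(a₁a₂)` lie in
`Span(Λ₁Λ₂)`. -/
theorem z_s2_mul_mem_span (d n : ℕ) (hd : 2 ≤ d) (hn : 2 ≤ n)
    (a1 a2 : Hecke d n) (ha1 : a1 ∈ Lam1 d n) (ha2 : a2 ∈ LamG d n 2) :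
    zH d n * (a1 * a2) ∈ Submodule.span (R0 d) (Lam1 d n * LamG d n 2) ∧
    sH d n 2 * (a1 * a2) ∈ Submodule.span (R0 d) (Lam1 d n * LamG d n 2) := by
  obtain ⟨i, hi, rfl⟩ := ha1
  constructor
  · rw [← mul_assoc, ← pow_succ']
    exact DF_mul_Lam d n hd hn (DF_a _ _ (0 + 1) _) ha2
  · rw [← mul_assoc]
    refine DF_mul_Lam d n hd hn (k := i) ?_ ha2
    simpa using DF_b (R := R0 d) (zH d n) (sH d n 2) 0 (Nat.le_succ i)
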